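/- Let m ∈ ℕ, k⃗ = (kₙ)_{n∈ℕ} an increasing sequence of positive integers and r, s ∈ ℕ. If W^m(Σ,k⃗;υ) = A₁ ∪ … ∪ A_r and W^m(Σ,k⃗) = C₁ ∪ … ∪ C_s, then there exist a sequence w⃗ = (wₙ)_{n∈ℕ} ∈ W^∞(Σ,k⃗;υ) and indices 1 ≤ i₀ ≤ r, 1 ≤ j₀ ≤ s such that RV^m(w⃗) ⊆ A_{i₀} and R^m(w⃗) ⊆ C_{j₀}. -/

import Mathlib

namespace Farmaki

/-- An ω-word is a list of letters; `0` is the variable `υ` and `a ≥ 1` is the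
letter `αₐ`.  A variable ω-word dominated by `k`: nonempty, with the letter at
(0-based) position `i` at most `k i`, and containing the variable. -/
def WVar (k : ℕ → ℕ) (w : List ℕ) : Prop :=
  w ≠ [] ∧ (∀ (i : ℕ) (h : i < w.length), w.get ⟨i, h⟩ ≤ k i) ∧ 0 ∈ w

/-- A (constant) ω-word dominated by `k`. -/
def WConst (k : ℕ → ℕ) (w : List ℕ) : Prop :=
  w ≠ [] ∧ ∀ (i : ℕ) (h : i < w.length), 1 ≤ w.get ⟨i, h⟩ ∧ w.get ⟨i, h⟩ ≤ k i

/-- `w < u` for ω-words: `w` is shorter and `u` starts with `|w|` letters `α₁`. -/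
def wltW (w u : List ℕ) : Prop :=
  w.length < u.length ∧ ∀ (i : ℕ) (h : i < u.length), i < w.length → u.get ⟨i, h⟩ = 1

/-- Concatenation `w ⋆ u` of ω-words with `w < u`. -/
def starW (w u : List ℕ) : List ℕ := w ++ u.drop w.length

/-- The substitution `T_p` on ω-words. -/
def TpW (k : ℕ → ℕ) (p : ℕ) (w : List ℕ) : List ℕ :=
  w.mapIdx fun i a => if a = 0 ∧ p ≠ 0 then min p (k i) else a

/-- The combination `T_{p 0}(w (n 0)) ⋆ ⋯ ⋆ T_{p l}(w (n l))` of ω-words. -/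
def combW (k : ℕ → ℕ) (w : ℕ → List ℕ) {l : ℕ} (n p : Fin (l + 1) → ℕ) : List ℕ :=
  (List.ofFn fun i => TpW k (p i) (w (n i))).foldr starW []

/-- A member of `W^∞(Σ,k⃗;υ)`: an orderly infinite sequence of variable ω-words. -/
def WOrderly (k : ℕ → ℕ) (w : ℕ → List ℕ) : Prop :=
  (∀ n, WVar k (w n)) ∧ ∀ n, wltW (w n) (w (n + 1))

end Farmaki

namespace Farmaki

/-- The concatenation `T_{p a}(w a) ⋆ T_{p (a+1)}(w (a+1)) ⋆ ⋯ ⋆ T_{p (b-1)}(w (b-1))`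
of the block of words with indices in `[a, b)`. -/
def blockCombW (k : ℕ → ℕ) (w : ℕ → List ℕ) (p : ℕ → ℕ) (a b : ℕ) : List ℕ :=
  ((List.range' a (b - a)).map fun j => TpW k (p j) (w j)).foldr starW []

/-- `RV^m(w⃗)`: reduced `m`-sequences of variable ω-words of `w⃗`. -/
def RVm (k : ℕ → ℕ) (w : ℕ → List ℕ) (m : ℕ) : Set (Fin m → List ℕ) :=
  {u | ∃ (lam : Fin (m + 1) → ℕ) (p : ℕ → ℕ), lam 0 = 0 ∧ StrictMono lam ∧
    (∀ j, p j ≤ k j) ∧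
    (∀ i : Fin m, ∃ j, lam i.castSucc ≤ j ∧ j < lam i.succ ∧ p j = 0) ∧
    ∀ i : Fin m, u i = blockCombW k w p (lam i.castSucc) (lam i.succ)}

/-- `R^m(w⃗)`: reduced `m`-sequences of (constant) ω-words of `w⃗`. -/
def Rm (k : ℕ → ℕ) (w : ℕ → List ℕ) (m : ℕ) : Set (Fin m → List ℕ) :=
  {u | ∃ (lam : Fin (m + 1) → ℕ) (p : ℕ → ℕ), lam 0 = 0 ∧ StrictMono lam ∧
    (∀ j, 1 ≤ p j ∧ p j ≤ k j) ∧
    ∀ i : Fin m, u i = blockCombW k w p (lam i.castSucc) (lam i.succ)}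

section CompactSemigroup

/-- In a compact right topological semigroup, a closed subsemigroup `S` has an idempotent `e` that
is minimal in the natural order of the idempotents of `S`. -/
theorem exists_minimal_idempotent {X : Type*} [Semigroup X] [TopologicalSpace X] [CompactSpace X]
    [T2Space X] (hc : ∀ r : X, Continuous (· * r)) {S : Set X} (hS : IsClosed S)
    (hne : S.Nonempty) (hSS : ∀ x ∈ S, ∀ y ∈ S, x * y ∈ S) :
    ∃ e ∈ S, e * e = e ∧ ∀ g ∈ S, g * g = g → g * e = g → e * g = g → g = e := by
  let I : Set (Set X) :=
    {N | IsClosed N ∧ N.Nonempty ∧ N ⊆ S ∧ ∀ x ∈ S, ∀ y ∈ N, x * y ∈ N}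
  obtain ⟨N, -, hN⟩ : ∃ N, N ⊆ S ∧ Minimal (· ∈ I) N := by
    refine zorn_superset_nonempty I (fun c hcI hchain hcne => ?_) S ⟨hS, hne, subset_rfl, hSS⟩
    obtain ⟨N₀, hN₀⟩ := hcne
    refine ⟨⋂₀ c, ⟨isClosed_sInter fun t ht => (hcI ht).1, ?_,
      (Set.sInter_subset_of_mem hN₀).trans (hcI hN₀).2.2.1, fun x hx y hy => ?_⟩,
      fun s hs => Set.sInter_subset_of_mem hs⟩
    · rw [Set.sInter_eq_iInter]
      have : Nonempty c := ⟨⟨N₀, hN₀⟩⟩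
      exact IsCompact.nonempty_iInter_of_directed_nonempty_isCompact_isClosed _
        (DirectedOn.directed_val (IsChain.directedOn hchain.symm))
        (fun i => (hcI i.prop).2.1) (fun i => (hcI i.prop).1.isCompact)
        (fun i => (hcI i.prop).1)
    · exact Set.mem_sInter.2 fun t ht => (hcI ht).2.2.2 x hx y (Set.mem_sInter.1 hy t ht)
  obtain ⟨hNc, hNne, hNS, hSN⟩ := hN.prop
  obtain ⟨e, heN, hee⟩ := exists_idempotent_in_compact_subsemigroup hc N hNne hNc.isCompact
    fun x hx y hy => hSN x (hNS hx) y hy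
  refine ⟨e, hNS heN, hee, fun g hg hgg hge heg => ?_⟩
  have hgN : g ∈ N := hge ▸ hSN g hg e heN
  have hSg : (· * g) '' N = N := by
    apply hN.eq_of_subset
    · refine ⟨(hc g).isClosedMap _ hNc, hNne.image _, ?_, ?_⟩
      · rintro _ ⟨x, hx, rfl⟩
        exact hSS x (hNS hx) g hg
      · rintro x hx _ ⟨y, hy, rfl⟩
        exact ⟨x * y, hSN x hx y hy, mul_assoc _ _ _⟩
    · rintro _ ⟨x, hx, rfl⟩
      exact hSN x (hNS hx) g hgN
  obtain ⟨x, -, hx⟩ : e ∈ (· * g) '' N := by rwa [hSg]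
  calc g = e * g := heg.symm
    _ = x * g * g := by rw [← hx]
    _ = e := by rw [mul_assoc, hgg]; exact hx

/-- Below any idempotent `e` there is an idempotent in every closed set `T` stable under
multiplication by `T` and by `e`. -/
theorem exists_idempotent_le {X : Type*} [Semigroup X] [TopologicalSpace X] [CompactSpace X]
    [T2Space X] (hc : ∀ r : X, Continuous (· * r)) {T : Set X} (hT : IsClosed T)
    (hne : T.Nonempty) (hTT : ∀ x ∈ T, ∀ y ∈ T, x * y ∈ T) {e : X} (he : e * e = e)
    (heT : ∀ y ∈ T, e * y ∈ T) (hTe : ∀ y ∈ T, y * e ∈ T) :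
    ∃ f ∈ T, f * f = f ∧ e * f = f ∧ f * e = f := by
  obtain ⟨f, ⟨x, hx, hxf⟩, hff⟩ := exists_idempotent_in_compact_subsemigroup hc ((· * e) '' T)
    (hne.image _) (hT.isCompact.image (hc e)) (by
      rintro _ ⟨x, hx, rfl⟩ _ ⟨y, hy, rfl⟩
      exact ⟨x * e * y, hTT _ (hTe x hx) _ hy, mul_assoc _ _ _⟩)
  have hfT : f ∈ T := hxf ▸ hTe x hx
  have hfe : f * e = f := by
    rw [← hxf]
    simp only [mul_assoc, he]
  refine ⟨e * f, heT f hfT, ?_, ?_, ?_⟩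
  · rw [mul_assoc, ← mul_assoc f, hfe, hff]
  · rw [← mul_assoc, he]
  · rw [mul_assoc, hfe]

end CompactSemigroup

section Fusion

open Filter

/-- A sequence of points of a filter, chosen so that the finitely many states reached at each
step stay good. -/
theorem exists_seq_forall_good {X W : Type*} (F : Filter W) [F.NeBot] (good : X → Prop)
    (next : ℕ → W → X → Set X) (hfin : ∀ n w x, (next n w x).Finite)
    (hnext : ∀ n x, good x → ∀ᶠ w in F, ∀ y ∈ next n w x, good y)
    (P : W → Prop) (hP : ∀ᶠ w in F, P w)
    (R : W → W → Prop) (hR : ∀ v, ∀ᶠ w in F, R v w)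
    (G₀ : Set X) (hG₀ : G₀.Finite) (hgood : ∀ x ∈ G₀, good x) :
    ∃ (w : ℕ → W) (G : ℕ → Set X), (∀ n, P (w n)) ∧ (∀ n, R (w n) (w (n + 1))) ∧ G 0 = G₀ ∧
      (∀ n, ∀ x ∈ G n, next n (w n) x ⊆ G (n + 1)) ∧ ∀ n, ∀ x ∈ G n, good x := by
  have key : ∀ (n : ℕ) (G : {G : Set X // G.Finite ∧ ∀ x ∈ G, good x}) (v : W),
      ∃ w, P w ∧ R v w ∧ ∀ x ∈ G.1, ∀ y ∈ next n w x, good y := by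
    intro n G v
    have h := (eventually_all_finite G.2.1).2 fun x hx => hnext n x (G.2.2 x hx)
    exact (hP.and ((hR v).and h)).exists
  choose c hcP hcR hcG using key
  obtain ⟨v₀⟩ : Nonempty W := F.nonempty_of_neBot
  let step : ℕ → {G : Set X // G.Finite ∧ ∀ x ∈ G, good x} × W →
      {G : Set X // G.Finite ∧ ∀ x ∈ G, good x} × W := fun n q =>
    (⟨⋃ x ∈ q.1.1, next n (c n q.1 q.2) x, q.1.2.1.biUnion fun x _ => hfin _ _ _, by
      intro y hy
      simp only [Set.mem_iUnion] at hy
      obtain ⟨x, hx, hy⟩ := hy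
      exact hcG n q.1 q.2 x hx y hy⟩, c n q.1 q.2)
  let q : ℕ → {G : Set X // G.Finite ∧ ∀ x ∈ G, good x} × W :=
    fun n => Nat.rec (⟨G₀, hG₀, hgood⟩, v₀) step n
  refine ⟨fun n => c n (q n).1 (q n).2, fun n => (q n).1.1, fun n => hcP _ _ _,
    fun n => hcR (n + 1) (q (n + 1)).1 (q (n + 1)).2, rfl, fun n x hx y hy => ?_,
    fun n => (q n).1.2.2⟩
  exact Set.mem_biUnion (s := (q n).1.1) hx hy

end Fusion

section Blocks

open Filter

attribute [local instance] Ultrafilter.mul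

/-- The ultrafilter of lists of length `n` whose entries are successively `g`-generic. -/
def genericTuples {M : Type*} (g : Ultrafilter M) : ℕ → Ultrafilter (List M)
  | 0 => pure []
  | n + 1 => g.bind fun u => (genericTuples g n).map (List.cons u)

theorem eventually_genericTuples_succ {M : Type*} {g : Ultrafilter M} {n : ℕ}
    {Q : List M → Prop} :
    (∀ᶠ l in genericTuples g (n + 1), Q l) ↔
      ∀ᶠ u in g, ∀ᶠ l in genericTuples g n, Q (u :: l) :=
  Iff.rfl

theorem eventually_genericTuples_forall_mem {M : Type*} {g : Ultrafilter M} {P : M → Prop}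
    (h : ∀ᶠ u in g, P u) (n : ℕ) : ∀ᶠ l in (genericTuples g n : Filter (List M)), ∀ u ∈ l, P u := by
  induction n with
  | zero =>
    change ∀ u ∈ ([] : List M), P u
    simp
  | succ n ih =>
    rw [eventually_genericTuples_succ]
    filter_upwards [h] with u hu
    filter_upwards [ih] with l hl
    simpa using ⟨hu, hl⟩

theorem eventually_genericTuples_pairwise {M : Type*} {g : Ultrafilter M} {R : M → M → Prop}
    (h : ∀ v, ∀ᶠ u in g, R v u) (n : ℕ) : ∀ᶠ l in (genericTuples g n : Filter (List M)), l.Pairwise R := by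
  induction n with
  | zero => exact List.Pairwise.nil (R := R)
  | succ n ih =>
    rw [eventually_genericTuples_succ]
    refine Eventually.of_forall fun u => ?_
    filter_upwards [ih, eventually_genericTuples_forall_mem (h u) n] with l hl hu
    exact List.pairwise_cons.2 ⟨hu, hl⟩

theorem eventually_genericTuples_length {M : Type*} (g : Ultrafilter M) (n : ℕ) :
    ∀ᶠ l in (genericTuples g n : Filter (List M)), l.length = n := by
  induction n with
  | zero => exact List.length_nil (α := M)
  | succ n ih =>
    rw [eventually_genericTuples_succ]
    refine Eventually.of_forall fun u => ?_
    filter_upwards [ih] with l hl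
    simp [hl]

/-- A partially built sequence of block products: `remaining` products, each of type `target`,
are still to be found so that their list satisfies `pred`; the product being built is `word`,
of type `seen`. -/
structure BlockState (M : Type*) where
  /-- the type of the products -/
  target : Fin 3
  /-- the number of products still missing -/
  remaining : ℕ
  /-- the condition on the missing products -/
  pred : List M → Prop
  /-- the type of the current product -/
  seen : Fin 3
  /-- the current product -/
  word : M

namespace BlockState

variable {M : Type*} [Monoid M]

/-- Generic completions of the state satisfy its condition. -/
def Good (U : Fin 3 → Ultrafilter M) : BlockState M → Prop
  | ⟨_, 0, Q, _, _⟩ => Q []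
  | ⟨t, n + 1, Q, x, c⟩ =>
    ∀ y, x ⊔ y = t → ∀ᶠ v in U y, ∀ᶠ l in genericTuples (U t) n, Q (c * v :: l)

/-- Multiply the current product by an element of type `a`. -/
def advance (a : Fin 3) (v : M) : BlockState M → BlockState M
  | ⟨t, n, Q, x, c⟩ => ⟨t, n, Q, x ⊔ a, c * v⟩

/-- Close the current product, if it has the right type, and start a new one. -/
def restart : BlockState M → BlockState M
  | ⟨t, 0, Q, x, c⟩ => ⟨t, 0, Q, x, c⟩
  | ⟨t, n + 1, Q, x, c⟩ => if x = t then ⟨t, n, fun l => Q (c :: l), 0, 1⟩ else ⟨t, n + 1, Q, x, c⟩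

theorem Good.restart {U : Fin 3 → Ultrafilter M} (hU₀ : U 0 = pure 1) {s : BlockState M}
    (h : s.Good U) : s.restart.Good U := by
  obtain ⟨t, _ | n, Q, x, c⟩ := s
  · exact h
  · simp only [BlockState.restart]
    split_ifs with hx
    · have h0 := h 0 (by subst hx; simp)
      rw [hU₀] at h0
      have h1 : ∀ᶠ l in genericTuples (U t) n, Q (c * 1 :: l) := h0
      rw [mul_one] at h1
      cases n with
      | zero => exact h1
      | succ n =>
        intro y hy
        have : y = t := by simpa using hy
        subst this
        simpa only [one_mul] using eventually_genericTuples_succ.1 h1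
    · exact h

theorem Good.advance {U : Fin 3 → Ultrafilter M} (hU : ∀ x y, U (x ⊔ y) = U x * U y)
    {s : BlockState M} (h : s.Good U) (a : Fin 3) :
    ∀ᶠ v in U a, (s.advance a v).Good U := by
  obtain ⟨t, _ | n, Q, x, c⟩ := s
  · exact Eventually.of_forall fun _ => h
  · change ∀ᶠ v in U a, ∀ y, x ⊔ a ⊔ y = t →
      ∀ᶠ v' in U y, ∀ᶠ l in genericTuples (U t) n, Q (c * v * v' :: l)
    refine eventually_all.2 fun y => eventually_imp_distrib_left.2 fun hy => ?_
    have := h (a ⊔ y) (by rw [← hy, sup_assoc])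
    rw [hU, Ultrafilter.eventually_mul] at this
    simpa only [mul_assoc] using this

end BlockState

variable {M : Type*} [Monoid M]

/-- Given a system `U` of ultrafilters multiplying like the chain `0 < 1 < 2`, and maps `φ p`
sending `U 2` to `U (τ p)`, there is a sequence all of whose finite families of consecutive block
products of type `t` satisfy a prescribed condition that holds for `U t`-generic tuples. -/
theorem exists_seq_block_products {U : Fin 3 → Ultrafilter M} (hU₀ : U 0 = pure 1)
    (hU : ∀ x y, U (x ⊔ y) = U x * U y) (τ : ℕ → Fin 3) (φ : ℕ → M → M)
    (hφ : ∀ p, (U 2).map (φ p) = U (τ p)) (k : ℕ → ℕ)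
    (P : M → Prop) (hP : ∀ᶠ w in U 2, P w) (R : M → M → Prop) (hR : ∀ v, ∀ᶠ w in U 2, R v w)
    (m : ℕ) (Q : Fin 3 → List M → Prop) (hQ : ∀ t, ∀ᶠ l in genericTuples (U t) m, Q t l) :
    ∃ w : ℕ → M, (∀ n, P (w n)) ∧ (∀ n, R (w n) (w (n + 1))) ∧
      ∀ (t : Fin 3) (u : Fin m → M) (lam : Fin (m + 1) → ℕ) (p : ℕ → ℕ),
        lam 0 = 0 → StrictMono lam → (∀ j, p j ≤ k j) →
        (∀ i : Fin m, (Finset.Ico (lam i.castSucc) (lam i.succ)).sup (fun j => τ (p j)) = t) →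
        (∀ i : Fin m, u i = ((List.range' (lam i.castSucc) (lam i.succ - lam i.castSucc)).map
          fun j => φ (p j) (w j)).prod) →
        Q t (List.ofFn u) := by
  let next : ℕ → M → BlockState M → Set (BlockState M) := fun n w s =>
    ⋃ p ∈ Set.Iic (k n), {s.advance (τ p) (φ p w), (s.advance (τ p) (φ p w)).restart}
  have hnext : ∀ n s, s.Good U → ∀ᶠ w in U 2, ∀ y ∈ next n w s, y.Good U := by
    intro n s hs
    have : ∀ᶠ w in U 2, ∀ p ∈ Set.Iic (k n), (s.advance (τ p) (φ p w)).Good U := by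
      refine (eventually_all_finite (Set.finite_Iic _)).2 fun p _ => ?_
      have h := hs.advance hU (τ p)
      rw [← hφ] at h
      exact h
    filter_upwards [this] with w hw y hy
    simp only [next, Set.mem_iUnion] at hy
    obtain ⟨p, hp, rfl | rfl⟩ := hy
    · exact hw p hp
    · exact (hw p hp).restart hU₀
  have hfin : ∀ n w s, (next n w s).Finite := fun n w s =>
    (Set.finite_Iic _).biUnion fun p _ => Set.toFinite _
  obtain ⟨w, G, hwP, hwR, hG0, hGnext, hGgood⟩ := exists_seq_forall_good (U 2 : Filter M)
    (BlockState.Good U) next hfin hnext P hP R hR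
    (Set.range fun t => ⟨t, m, Q t, 0, 1⟩) (Set.finite_range _) (by
      rintro _ ⟨t, rfl⟩
      cases m with
      | zero => exact hQ t
      | succ n =>
        intro y hy
        have : y = t := by simpa using hy
        subst this
        simpa only [one_mul] using eventually_genericTuples_succ.1 (hQ y))
  refine ⟨w, hwP, hwR, fun t u lam p hlam0 hlam hp hsup hu => ?_⟩
  have hadv : ∀ n, ∀ s ∈ G n, s.advance (τ (p n)) (φ (p n) (w n)) ∈ G (n + 1) ∧
      (s.advance (τ (p n)) (φ (p n) (w n))).restart ∈ G (n + 1) := by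
    intro n s hs
    constructor <;> refine hGnext n s hs (Set.mem_biUnion (hp n) ?_) <;> simp
  have hblock : ∀ (n : ℕ) (Q' : List M → Prop) (a d : ℕ), (⟨t, n, Q', 0, 1⟩ : BlockState M) ∈ G a →
      (⟨t, n, Q', (Finset.Ico a (a + d)).sup (fun j => τ (p j)),
        ((List.range' a d).map fun j => φ (p j) (w j)).prod⟩ : BlockState M) ∈ G (a + d) ∧
      (0 < d → (⟨t, n, Q', (Finset.Ico a (a + d)).sup (fun j => τ (p j)),
        ((List.range' a d).map fun j => φ (p j) (w j)).prod⟩ : BlockState M).restart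
          ∈ G (a + d)) := by
    intro n Q' a d hs
    induction d with
    | zero => exact ⟨by simpa [show (⊥ : Fin 3) = 0 from rfl] using hs, by simp⟩
    | succ d ih =>
      have h := hadv _ _ ih.1
      simp only [BlockState.advance] at h
      rw [← add_assoc, ← Finset.insert_Ico_right_eq_Ico_add_one (by omega), Finset.sup_insert,
        sup_comm, List.range'_1_concat]
      simpa using h
  have hind : ∀ (j : ℕ) (hj : j ≤ m), (⟨t, m - j, fun l => Q t ((List.ofFn u).take j ++ l),
      0, 1⟩ : BlockState M) ∈ G (lam ⟨j, by omega⟩) := by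
    intro j
    induction j with
    | zero =>
      intro _
      have : lam ⟨0, by omega⟩ = 0 := hlam0
      rw [this, hG0]
      exact ⟨t, by simp⟩
    | succ j ih =>
      intro hj
      have hlt : lam (Fin.castSucc ⟨j, hj⟩) < lam (Fin.succ ⟨j, hj⟩) :=
        hlam Fin.castSucc_lt_succ
      have h := (hblock _ _ _ (lam (Fin.succ ⟨j, hj⟩) - lam (Fin.castSucc ⟨j, hj⟩))
        (ih (by omega))).2 (by omega)
      change _ ∈ G (lam (Fin.castSucc ⟨j, hj⟩) + _) at h
      rw [← Fin.castSucc_mk m j hj, Nat.add_sub_cancel' hlt.le, hsup, ← hu,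
        show m - j = m - (j + 1) + 1 by omega] at h
      simp only [BlockState.restart, if_true] at h
      have htake : ∀ l, (List.ofFn u).take (j + 1) ++ l =
          (List.ofFn u).take j ++ u ⟨j, hj⟩ :: l := by
        intro l
        rw [List.take_succ_eq_append_getElem (by simpa using Nat.lt_of_succ_le hj)]
        simp
      simp only [htake]
      exact h
  have h := hGgood _ _ (hind m le_rfl)
  simp only [Nat.sub_self, BlockState.Good, List.append_nil] at h
  rwa [List.take_of_length_le (by simp)] at h

end Blocks

section Words

open Filter

/-- The words form a monoid under `⋆`. -/
@[reducible] def starMonoid : Monoid (List ℕ) where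
  mul := starW
  one := []
  mul_assoc u v w := by
    change starW (starW u v) w = starW u (starW v w)
    simp only [starW, List.append_assoc, List.drop_append, List.length_append, List.drop_drop,
      List.length_drop]
    congr 3
    omega
  one_mul w := by
    change starW [] w = w
    simp [starW]
  mul_one w := by
    change starW w [] = w
    simp [starW]

attribute [local instance] starMonoid Ultrafilter.mul Ultrafilter.semigroup

theorem wConst_iff {k : ℕ → ℕ} {w : List ℕ} :
    WConst k w ↔ w ≠ [] ∧ ∀ (i : ℕ) (h : i < w.length), 1 ≤ w[i] ∧ w[i] ≤ k i := Iff.rfl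

theorem wVar_iff {k : ℕ → ℕ} {w : List ℕ} :
    WVar k w ↔ w ≠ [] ∧ (∀ (i : ℕ) (h : i < w.length), w[i] ≤ k i) ∧ 0 ∈ w := Iff.rfl

theorem wltW_iff {w u : List ℕ} :
    wltW w u ↔ w.length < u.length ∧ ∀ (i : ℕ) (h : i < u.length), i < w.length → u[i] = 1 :=
  Iff.rfl

theorem getElem_starW_cases {P : ℕ → ℕ → Prop} {u v : List ℕ}
    (hu : ∀ (i : ℕ) (h : i < u.length), P i u[i]) (hv : ∀ (i : ℕ) (h : i < v.length), P i v[i])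
    (i : ℕ) (h : i < (starW u v).length) : P i (starW u v)[i] := by
  simp only [starW, List.length_append, List.length_drop] at h
  simp only [starW, List.getElem_append]
  split_ifs with hi
  · exact hu i hi
  · rw [List.getElem_drop]
    have := hv i (by omega)
    simpa only [Nat.add_sub_cancel' (not_lt.1 hi)] using this

theorem starW_ne_nil {u v : List ℕ} (hu : u ≠ []) : starW u v ≠ [] := by
  simp [starW, hu]

theorem WConst.starW {k : ℕ → ℕ} {u v : List ℕ} (hu : WConst k u) (hv : WConst k v) :
    WConst k (starW u v) :=
  ⟨starW_ne_nil hu.1, getElem_starW_cases (P := fun i a => 1 ≤ a ∧ a ≤ k i) hu.2 hv.2⟩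

theorem WConst.le {k : ℕ → ℕ} {u : List ℕ} (hu : WConst k u) (i : ℕ) (h : i < u.length) :
    u[i] ≤ k i :=
  (hu.2 i h).2

theorem starW_wVar_of_left {k : ℕ → ℕ} {u v : List ℕ} (hu : WVar k u)
    (hv : ∀ (i : ℕ) (h : i < v.length), v[i] ≤ k i) : WVar k (starW u v) :=
  ⟨starW_ne_nil hu.1, getElem_starW_cases (P := fun i a => a ≤ k i) hu.2.1 hv,
    List.mem_append_left _ hu.2.2⟩

theorem starW_wVar_of_right {k : ℕ → ℕ} {u v : List ℕ} (hne : u ≠ [])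
    (hu : ∀ (i : ℕ) (h : i < u.length), u[i] ≤ k i) (hv : WVar k v) (huv : wltW u v) :
    WVar k (starW u v) := by
  refine ⟨starW_ne_nil hne, getElem_starW_cases (P := fun i a => a ≤ k i) hu hv.2.1,
    List.mem_append_right _ ?_⟩
  obtain ⟨i, hi, h0⟩ := List.getElem_of_mem hv.2.2
  rw [List.mem_iff_getElem]
  have hle : u.length ≤ i := by
    by_contra! hlt
    have := (wltW_iff.1 huv).2 i hi hlt
    omega
  refine ⟨i - u.length, by simp; omega, ?_⟩
  rw [List.getElem_drop]
  rw [← h0]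
  congr 1
  omega

theorem wltW.starW_right {v u w : List ℕ} (h : wltW v u) : wltW v (starW u w) := by
  refine ⟨by simp only [starW, List.length_append]; have := h.1; omega, fun i hi hv => ?_⟩
  have := (wltW_iff.1 h).2 i (hv.trans h.1) hv
  simp only [starW, List.get_eq_getElem]
  rwa [List.getElem_append_left (hv.trans h.1)]

theorem tpW_zero (k : ℕ → ℕ) (w : List ℕ) : TpW k 0 w = w := by
  apply List.ext_getElem <;> simp [TpW]

theorem WConst.tpW {k : ℕ → ℕ} {w : List ℕ} (hw : WConst k w) (p : ℕ) : TpW k p w = w := by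
  apply List.ext_getElem
  · simp [TpW]
  · intro i h₁ h₂
    have := (wConst_iff.1 hw).2 i h₂
    simp only [TpW, List.getElem_mapIdx]
    rw [if_neg (by omega)]

theorem WVar.wConst_tpW {k : ℕ → ℕ} (hk : ∀ n, 0 < k n) {w : List ℕ} (hw : WVar k w) {p : ℕ}
    (hp : p ≠ 0) : WConst k (TpW k p w) := by
  rw [wConst_iff]
  refine ⟨by simpa [TpW] using hw.1, fun i h => ?_⟩
  have h' : i < w.length := by simpa [TpW] using h
  have := (wVar_iff.1 hw).2.1 i h'
  have := hk i
  simp only [TpW, List.getElem_mapIdx]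
  split_ifs <;> omega

theorem wltW.tpW {v w : List ℕ} (h : wltW v w) (k : ℕ → ℕ) (p : ℕ) : wltW v (TpW k p w) := by
  rw [wltW_iff] at h ⊢
  refine ⟨by simpa [TpW] using h.1, fun i hi hv => ?_⟩
  have := h.2 i (hv.trans h.1) hv
  simp [TpW, this]

theorem tpW_starW (k : ℕ → ℕ) (p : ℕ) (u v : List ℕ) :
    TpW k p (starW u v) = starW (TpW k p u) (TpW k p v) := by
  apply List.ext_getElem
  · simp [TpW, starW]
  · intro i h₁ h₂
    simp only [TpW, starW, List.getElem_mapIdx, List.getElem_append, List.length_mapIdx,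
      List.getElem_drop]
    split_ifs with h <;> grind

/-- The ultrafilters concentrating on words with property `P` beyond every given word. -/
def tailUltrafilters (P : List ℕ → Prop) : Set (Ultrafilter (List ℕ)) :=
  {U | (∀ᶠ w in (U : Filter (List ℕ)), P w) ∧ ∀ v, ∀ᶠ w in (U : Filter (List ℕ)), wltW v w}

theorem isClosed_tailUltrafilters (P : List ℕ → Prop) : IsClosed (tailUltrafilters P) := by
  have : tailUltrafilters P = {U | {w | P w} ∈ U} ∩ ⋂ v, {U | {w | wltW v w} ∈ U} := by
    ext U
    simp [tailUltrafilters, Filter.Eventually]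
  rw [this]
  exact (ultrafilter_isClosed_basic _).inter
    (isClosed_iInter fun v => ultrafilter_isClosed_basic _)

theorem tailUltrafilters_nonempty {P : List ℕ → Prop} (h : ∀ v, ∃ w, P w ∧ wltW v w) :
    (tailUltrafilters P).Nonempty := by
  have h' : ∀ n : ℕ, ∃ w, P w ∧ wltW (List.replicate n 0) w := fun n => h _
  choose c hcP hc using h'
  refine ⟨(hyperfilter ℕ).map c, Eventually.of_forall (f := (hyperfilter ℕ : Filter ℕ)) hcP,
    fun v => ?_⟩
  have : ∀ᶠ n in (hyperfilter ℕ : Filter ℕ), v.length ≤ n :=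
    Nat.hyperfilter_le_atTop (eventually_ge_atTop _)
  change ∀ᶠ n in (hyperfilter ℕ : Filter ℕ), wltW v (c n)
  filter_upwards [this] with n hn
  have := hc n
  simp only [wltW, List.length_replicate] at this ⊢
  exact ⟨hn.trans_lt this.1, fun i hi hv => this.2 i hi (hv.trans_le hn)⟩

theorem mul_mem_tailUltrafilters {P Q S : List ℕ → Prop}
    (h : ∀ u v, P u → Q v → wltW u v → S (starW u v)) {U V : Ultrafilter (List ℕ)}
    (hU : U ∈ tailUltrafilters P) (hV : V ∈ tailUltrafilters Q) :
    U * V ∈ tailUltrafilters S := by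
  refine ⟨(Ultrafilter.eventually_mul U V S).2 ?_,
    fun v => (Ultrafilter.eventually_mul U V (wltW v)).2 ?_⟩
  · filter_upwards [hU.1] with u hu
    filter_upwards [hV.1, hV.2 u] with v hv huv
    exact h u v hu hv huv
  · filter_upwards [hU.2 v] with u hu
    exact Eventually.of_forall fun w => hu.starW_right

theorem map_tpW_mul (k : ℕ → ℕ) (p : ℕ) (U V : Ultrafilter (List ℕ)) :
    (U * V).map (TpW k p) = U.map (TpW k p) * V.map (TpW k p) := by
  refine Ultrafilter.coe_injective (Filter.ext fun s => ?_)
  change (∀ᶠ u in (U : Filter (List ℕ)), ∀ᶠ v in (V : Filter (List ℕ)),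
      TpW k p (starW u v) ∈ s) ↔ ∀ᶠ u in (U : Filter (List ℕ)), ∀ᶠ v in (V : Filter (List ℕ)),
      starW (TpW k p u) (TpW k p v) ∈ s
  simp only [tpW_starW]

/-- The pair of idempotents behind the partition theorem. -/
theorem exists_idempotent_pair (k : ℕ → ℕ) (hk : ∀ n, 0 < k n) :
    ∃ e ∈ tailUltrafilters (WConst k), ∃ f ∈ tailUltrafilters (WVar k),
      e * e = e ∧ f * f = f ∧ e * f = f ∧ f * e = f ∧ ∀ p ≠ 0, f.map (TpW k p) = e := by
  have hone : ∀ n, ∀ (i : ℕ) (h : i < (List.replicate n 1).length),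
      1 ≤ (List.replicate n 1)[i] ∧ (List.replicate n 1)[i] ≤ k i := by
    intro n i h
    simpa using Nat.succ_le_of_lt (hk i)
  obtain ⟨e, heS, hee, hmin⟩ := exists_minimal_idempotent
    (Ultrafilter.continuous_mul_left (M := List ℕ)) (isClosed_tailUltrafilters (WConst k))
    (tailUltrafilters_nonempty fun v => ⟨List.replicate (v.length + 1) 1,
      ⟨by simp, hone _⟩, by simp [wltW]⟩)
    fun U hU V hV => mul_mem_tailUltrafilters (fun _ _ hu hv _ => hu.starW hv) hU hV
  obtain ⟨f, hfT, hff, hef, hfe⟩ := exists_idempotent_le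
    (Ultrafilter.continuous_mul_left (M := List ℕ)) (isClosed_tailUltrafilters (WVar k))
    (tailUltrafilters_nonempty fun v => ⟨List.replicate (v.length + 1) 1 ++ [0], by
      rw [wVar_iff]
      refine ⟨by simp, fun i h => ?_, by simp⟩
      rw [List.getElem_append]
      split_ifs with hi
      · exact (hone _ i hi).2
      · simp, by
      rw [wltW_iff]
      refine ⟨by simp, fun i h hv => ?_⟩
      rw [List.getElem_append_left (by simp; omega)]
      simp⟩)
    (fun U hU V hV => mul_mem_tailUltrafilters
      (fun _ _ hu hv _ => starW_wVar_of_left hu hv.2.1) hU hV) hee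
    (fun V hV => mul_mem_tailUltrafilters
      (fun _ _ hu hv huv => starW_wVar_of_right hu.1 hu.le hv huv) heS hV)
    (fun U hU => mul_mem_tailUltrafilters (fun _ _ hu hv _ => starW_wVar_of_left hu hv.le) hU heS)
  refine ⟨e, heS, f, hfT, hee, hff, hef, hfe, fun p hp => ?_⟩
  have hTe : e.map (TpW k p) = e := by
    refine Ultrafilter.coe_injective ((Filter.map_congr ?_).trans Filter.map_id)
    filter_upwards [heS.1] with w hw
    exact hw.tpW p
  refine hmin _ ⟨?_, fun v => ?_⟩ ?_ ?_ ?_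
  · change ∀ᶠ w in (f : Filter (List ℕ)), WConst k (TpW k p w)
    filter_upwards [hfT.1] with w hw
    exact hw.wConst_tpW hk hp
  · change ∀ᶠ w in (f : Filter (List ℕ)), wltW v (TpW k p w)
    filter_upwards [hfT.2 v] with w hw
    exact hw.tpW k p
  · rw [← map_tpW_mul, hff]
  · conv_rhs => rw [← hfe, map_tpW_mul, hTe]
  · conv_rhs => rw [← hef, map_tpW_mul, hTe]

/-- One cell of a finite cover of the admissible tuples is generic. -/
theorem exists_eventually_genericTuples {P : List ℕ → Prop} {g : Ultrafilter (List ℕ)}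
    (hg : g ∈ tailUltrafilters P) {m r : ℕ} (A : Fin r → Set (Fin m → List ℕ))
    (hA : ∀ u : Fin m → List ℕ, (∀ i, P (u i)) →
      (∀ i j : Fin m, i < j → wltW (u i) (u j)) → ∃ i₀, u ∈ A i₀) :
    ∃ i₀, ∀ᶠ l in (genericTuples g m : Filter (List (List ℕ))),
      (fun i : Fin m => l.getD i []) ∈ A i₀ := by
  rw [← Ultrafilter.eventually_exists_iff]
  filter_upwards [eventually_genericTuples_forall_mem hg.1 m,
    eventually_genericTuples_pairwise hg.2 m, eventually_genericTuples_length g m] with l h₁ h₂ h₃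
  have hget : ∀ i : Fin m, l.getD i [] = l[(i : ℕ)]'(by omega) := fun i =>
    List.getD_eq_getElem _ _ _
  refine hA _ (fun i => ?_) fun i j hij => ?_
  · rw [hget]
    exact h₁ _ (List.getElem_mem _)
  · rw [hget, hget]
    exact List.pairwise_iff_getElem.1 h₂ i j _ _ hij

theorem sup_mul_of_idempotent_pair {e f : Ultrafilter (List ℕ)} (hee : e * e = e)
    (hff : f * f = f) (hef : e * f = f) (hfe : f * e = f) (x y : Fin 3) :
    (![pure 1, e, f] : Fin 3 → Ultrafilter (List ℕ)) (x ⊔ y) =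
      (![pure 1, e, f] : Fin 3 → Ultrafilter (List ℕ)) x *
        (![pure 1, e, f] : Fin 3 → Ultrafilter (List ℕ)) y := by
  have hl : ∀ U : Ultrafilter (List ℕ), pure 1 * U = U := fun U =>
    Ultrafilter.coe_injective (Filter.ext' fun p => by
      rw [Ultrafilter.eventually_mul]
      change (∀ᶠ v in (U : Filter (List ℕ)), p (1 * v)) ↔ _
      simp only [one_mul])
  have hr : ∀ U : Ultrafilter (List ℕ), U * pure 1 = U := fun U =>
    Ultrafilter.coe_injective (Filter.ext' fun p => by
      rw [Ultrafilter.eventually_mul]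
      change (∀ᶠ v in (U : Filter (List ℕ)), p (v * 1)) ↔ _
      simp only [mul_one])
  fin_cases x <;> fin_cases y <;> first
    | exact (hl _).symm
    | exact (hr _).symm
    | exact hee.symm
    | exact hff.symm
    | exact hef.symm
    | exact hfe.symm

end Words

/-- **Theorem 2.13** (Ramsey type partition theorem for ω-words). For finite partitions
of `W^m(Σ,k⃗;υ)` and `W^m(Σ,k⃗)` there exist `w⃗ ∈ W^∞(Σ,k⃗;υ)` and indices `i₀, j₀`
with `RV^m(w⃗) ⊆ A_{i₀}` and `R^m(w⃗) ⊆ C_{j₀}`. -/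
theorem ramsey_omega_words
    (k : ℕ → ℕ) (hk : ∀ n, 0 < k n) (hmono : Monotone k)
    (m : ℕ) (hm : 0 < m) (r s : ℕ) (hr : 0 < r) (hs : 0 < s)
    (A : Fin r → Set (Fin m → List ℕ)) (C : Fin s → Set (Fin m → List ℕ))
    (hA : ∀ u : Fin m → List ℕ, (∀ i, WVar k (u i)) →
      (∀ i j : Fin m, i < j → wltW (u i) (u j)) → ∃ i₀, u ∈ A i₀)
    (hC : ∀ u : Fin m → List ℕ, (∀ i, WConst k (u i)) →
      (∀ i j : Fin m, i < j → wltW (u i) (u j)) → ∃ j₀, u ∈ C j₀) :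
    ∃ w : ℕ → List ℕ, WOrderly k w ∧ ∃ (i₀ : Fin r) (j₀ : Fin s),
      RVm k w m ⊆ A i₀ ∧ Rm k w m ⊆ C j₀ := by
  obtain ⟨e, heS, f, hfT, hee, hff, hef, hfe, hmap⟩ := exists_idempotent_pair k hk
  obtain ⟨i₀, hi₀⟩ := exists_eventually_genericTuples hfT A hA
  obtain ⟨j₀, hj₀⟩ := exists_eventually_genericTuples heS C hC
  let := starMonoid
  obtain ⟨w, hwP, hwR, hw⟩ := exists_seq_block_products (U := ![pure 1, e, f]) rfl
    (sup_mul_of_idempotent_pair hee hff hef hfe) (fun p => if p = 0 then 2 else 1) (TpW k)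
    (fun p => by
      split_ifs with hp
      · subst hp
        change f.map (TpW k 0) = f
        rw [show TpW k 0 = id from funext (tpW_zero k), Ultrafilter.map_id]
      · exact hmap p hp)
    k (WVar k) hfT.1 wltW hfT.2 m
    ![fun _ => True, fun l => (fun i : Fin m => l.getD i []) ∈ C j₀,
      fun l => (fun i : Fin m => l.getD i []) ∈ A i₀] (by
      intro t
      fin_cases t
      · exact Filter.Eventually.of_forall fun _ => trivial
      · exact hj₀
      · exact hi₀)
  have hofFn : ∀ u : Fin m → List ℕ, (fun i : Fin m => (List.ofFn u).getD i []) = u := by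
    intro u
    funext i
    simp
  refine ⟨w, ⟨hwP, hwR⟩, i₀, j₀, ?_, ?_⟩
  · rintro u ⟨lam, p, h0, hlam, hp, hvar, hu⟩
    rw [← hofFn u]
    refine hw 2 u lam p h0 hlam hp (fun i => ?_) hu
    obtain ⟨j, hj₁, hj₂, hj⟩ := hvar i
    refine le_antisymm (Fin.le_last _) ?_
    have := Finset.le_sup (f := fun j => if p j = 0 then (2 : Fin 3) else 1)
      (Finset.mem_Ico.2 ⟨hj₁, hj₂⟩)
    simpa only [hj, if_true] using this
  · rintro u ⟨lam, p, h0, hlam, hp, hu⟩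
    rw [← hofFn u]
    refine hw 1 u lam p h0 hlam (fun j => (hp j).2) (fun i => ?_) hu
    have hne : (Finset.Ico (lam i.castSucc) (lam i.succ)).Nonempty :=
      Finset.nonempty_Ico.2 (hlam Fin.castSucc_lt_succ)
    rw [Finset.sup_congr rfl (g := fun _ => (1 : Fin 3)) fun j _ => if_neg (by
      have := (hp j).1
      omega)]
    exact Finset.sup_const hne 1

end Farmaki
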